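/- (Finite-population variance of linear combinations of cohort means, used in Proposition 1.) Under Assumption 1, for any positive integer K and any fixed K×T real matrices A_g (g ∈ 𝒢), the random vector τ̂ := Σ_{g∈𝒢} A_g Ȳ_g has covariance matrix Var(τ̂) = Σ_{g∈𝒢} N_g^{-1} A_g S_g A_g′ − N^{-1} S_A, where S_A := S(Σ_{g∈𝒢} A_g Y(g)) is the finite-population covariance of the unit-level vectors Σ_{g∈𝒢} A_g Y_i(g). -/

import Mathlib

open Finset Filter Topology Matrix MeasureTheory ProbabilityTheory
open scoped BigOperators Classical ENNReal NNReal

noncomputable section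

namespace Staggered

/-- Treatment dates: `ℕ∞ = ℕ ∪ {∞}`; `⊤` means never treated. -/
abbrev Date : Type := ℕ∞

/-- Period `t : Fin T` stands for calendar period `t + 1`; `periodLT t g` says that period `t`
is strictly earlier than the treatment date `g` (i.e. `g > t`). -/
def periodLT {T : ℕ} (t : Fin T) (g : Date) : Prop := (((t : ℕ) + 1 : ℕ) : Date) < g

/-- Assumption 1 sample space: the valid assignment vectors, i.e. those in which exactly
`Ng g` units have first-treatment date `g`, for every `g ∈ 𝒢`. -/
def assigns (N : ℕ) (𝒢 : Finset Date) (Ng : Date → ℕ) : Finset (Fin N → 𝒢) :=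
  Finset.univ.filter fun d => ∀ g ∈ 𝒢, (Finset.univ.filter fun i => (d i : Date) = g).card = Ng g

/-- Expectation under the uniform distribution on valid assignments (Assumption 1). -/
def expec (N : ℕ) (𝒢 : Finset Date) (Ng : Date → ℕ) (f : (Fin N → 𝒢) → ℝ) : ℝ :=
  (∑ d ∈ assigns N 𝒢 Ng, f d) / ((assigns N 𝒢 Ng).card : ℝ)

/-- Probability of an event under the uniform distribution on valid assignments. -/
def prob (N : ℕ) (𝒢 : Finset Date) (Ng : Date → ℕ) (p : (Fin N → 𝒢) → Prop) : ℝ :=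
  (((assigns N 𝒢 Ng).filter p).card : ℝ) / ((assigns N 𝒢 Ng).card : ℝ)

/-- Variance of a real statistic under the uniform distribution on valid assignments. -/
def varE (N : ℕ) (𝒢 : Finset Date) (Ng : Date → ℕ) (f : (Fin N → 𝒢) → ℝ) : ℝ :=
  expec N 𝒢 Ng fun d => (f d - expec N 𝒢 Ng f) ^ 2

/-- Covariance of two real statistics under the uniform distribution on valid assignments. -/
def covE (N : ℕ) (𝒢 : Finset Date) (Ng : Date → ℕ) (f h : (Fin N → 𝒢) → ℝ) : ℝ :=
  expec N 𝒢 Ng fun d => (f d - expec N 𝒢 Ng f) * (h d - expec N 𝒢 Ng h)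

/-- Observed outcome vectors `Y_i = Y_i(G_i)`. -/
def obs {N T : ℕ} {𝒢 : Finset Date} (Y : Fin N → Date → Fin T → ℝ) (d : Fin N → 𝒢) :
    Fin N → Fin T → ℝ := fun i => Y i (d i)

/-- Cohort sample mean `Ȳ_g` computed from outcome data `y` and assignment `d`. -/
def cmean {N T : ℕ} {𝒢 : Finset Date} (Ng : Date → ℕ) (y : Fin N → Fin T → ℝ)
    (d : Fin N → 𝒢) (g : Date) : Fin T → ℝ :=
  fun t => (∑ i, if (d i : Date) = g then y i t else 0) / (Ng g : ℝ)

/-- Finite-population mean of a scalar attribute. -/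
def popMeanS (N : ℕ) (w : Fin N → ℝ) : ℝ := (∑ i, w i) / (N : ℝ)

/-- Finite-population variance (normalized by `N - 1`) of a scalar attribute. -/
def popVarS (N : ℕ) (w : Fin N → ℝ) : ℝ :=
  (∑ i, (w i - popMeanS N w) ^ 2) / ((N : ℝ) - 1)

/-- Finite-population mean of a vector attribute. -/
def popMeanV (N K : ℕ) (W : Fin N → Fin K → ℝ) : Fin K → ℝ := fun k => (∑ i, W i k) / (N : ℝ)

/-- Finite-population covariance matrix (normalized by `N - 1`) of a vector attribute. -/
def popCov (N K : ℕ) (W : Fin N → Fin K → ℝ) : Matrix (Fin K) (Fin K) ℝ :=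
  Matrix.of fun k l =>
    (∑ i, (W i k - popMeanV N K W k) * (W i l - popMeanV N K W l)) / ((N : ℝ) - 1)

/-- Finite-population cross-covariance matrix of two vector attributes. -/
def popCrossCov (N K : ℕ) (W V : Fin N → Fin K → ℝ) : Matrix (Fin K) (Fin K) ℝ :=
  Matrix.of fun k l =>
    (∑ i, (W i k - popMeanV N K W k) * (V i l - popMeanV N K V l)) / ((N : ℝ) - 1)

/-- `S_g`: finite-population covariance matrix of the potential outcomes `Y(g)`. -/
def Sg (N T : ℕ) (Y : Fin N → Date → Fin T → ℝ) (g : Date) : Matrix (Fin T) (Fin T) ℝ :=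
  popCov N T fun i => Y i g

/-- `S_{gg'}`: finite-population cross-covariance of `Y(g)` and `Y(g')`. -/
def Sgg (N T : ℕ) (Y : Fin N → Date → Fin T → ℝ) (g g' : Date) : Matrix (Fin T) (Fin T) ℝ :=
  popCrossCov N T (fun i => Y i g) (fun i => Y i g')

/-- Average treatment contrast `τ_{t,gg'}`. -/
def tau (N T : ℕ) (Y : Fin N → Date → Fin T → ℝ) (t : Fin T) (g g' : Date) : ℝ :=
  (∑ i, (Y i g t - Y i g' t)) / (N : ℝ)

/-- Target parameter `θ = Σ_{t,g,g'} a_{t,gg'} τ_{t,gg'}`. -/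
def thetaParam (N T : ℕ) (𝒢 : Finset Date) (Y : Fin N → Date → Fin T → ℝ)
    (a : Fin T → Date → Date → ℝ) : ℝ :=
  ∑ t, ∑ g ∈ 𝒢, ∑ g' ∈ 𝒢, a t g g' * tau N T Y t g g'

/-- Sample analog `θ̂₀` computed from outcome data `y` and assignment `d`. -/
def thetaHat0 {N T : ℕ} (𝒢 : Finset Date) (Ng : Date → ℕ) (a : Fin T → Date → Date → ℝ)
    (y : Fin N → Fin T → ℝ) (d : Fin N → 𝒢) : ℝ :=
  ∑ t, ∑ g ∈ 𝒢, ∑ g' ∈ 𝒢, a t g g' * (cmean Ng y d g t - cmean Ng y d g' t)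

/-- The statistic `X̂` computed from outcome data `y` and assignment `d`. -/
def Xhat {N T M : ℕ} (𝒢 : Finset Date) (Ng : Date → ℕ)
    (b : Fin M → Fin T → Date → Date → ℝ) (y : Fin N → Fin T → ℝ) (d : Fin N → 𝒢) :
    Fin M → ℝ :=
  fun j => ∑ t, ∑ g ∈ 𝒢, ∑ g' ∈ 𝒢, b j t g g' * (cmean Ng y d g t - cmean Ng y d g' t)

/-- Induced row vector `A_{θ,g}` of weights on `Ȳ_g` in `θ̂₀`. -/
def Atheta (T : ℕ) (𝒢 : Finset Date) (a : Fin T → Date → Date → ℝ) (g : Date) :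
    Fin T → ℝ := fun t => ∑ g' ∈ 𝒢, (a t g g' - a t g' g)

/-- Induced `M × T` matrix `A_{0,g}` of weights on `Ȳ_g` in `X̂`. -/
def A0 (T M : ℕ) (𝒢 : Finset Date) (b : Fin M → Fin T → Date → Date → ℝ) (g : Date) :
    Matrix (Fin M) (Fin T) ℝ :=
  Matrix.of fun j t => ∑ g' ∈ 𝒢, (b j t g g' - b j t g' g)

/-- `S_θ`: finite-population variance of the unit-level scalars `Σ_g A_{θ,g} Y_i(g)`. -/
def Stheta (N T : ℕ) (𝒢 : Finset Date) (Y : Fin N → Date → Fin T → ℝ)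
    (a : Fin T → Date → Date → ℝ) : ℝ :=
  popVarS N fun i => ∑ g ∈ 𝒢, Atheta T 𝒢 a g ⬝ᵥ Y i g

/-- Within-cohort sample covariance `Ŝ_g` from outcome data `y` and assignment `d`. -/
def Shat {N T : ℕ} {𝒢 : Finset Date} (Ng : Date → ℕ) (y : Fin N → Fin T → ℝ)
    (d : Fin N → 𝒢) (g : Date) : Matrix (Fin T) (Fin T) ℝ :=
  Matrix.of fun t t' =>
    (∑ i, if (d i : Date) = g then
      (y i t - cmean Ng y d g t) * (y i t' - cmean Ng y d g t') else 0) / ((Ng g : ℝ) - 1)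

/-- Plug-in estimate `V̂_{X̂}`. -/
def VhatX {N T M : ℕ} (𝒢 : Finset Date) (Ng : Date → ℕ)
    (b : Fin M → Fin T → Date → Date → ℝ) (y : Fin N → Fin T → ℝ) (d : Fin N → 𝒢) :
    Matrix (Fin M) (Fin M) ℝ :=
  ∑ g ∈ 𝒢, ((Ng g : ℝ))⁻¹ • (A0 T M 𝒢 b g * Shat Ng y d g * (A0 T M 𝒢 b g)ᵀ)

/-- Plug-in estimate `V̂_{X̂,θ̂₀}`. -/
def VhatXtheta {N T M : ℕ} (𝒢 : Finset Date) (Ng : Date → ℕ)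
    (a : Fin T → Date → Date → ℝ) (b : Fin M → Fin T → Date → Date → ℝ)
    (y : Fin N → Fin T → ℝ) (d : Fin N → 𝒢) : Fin M → ℝ :=
  ∑ g ∈ 𝒢, ((Ng g : ℝ))⁻¹ • ((A0 T M 𝒢 b g * Shat Ng y d g).mulVec (Atheta T 𝒢 a g))

/-- Plug-in coefficient `β̂* = V̂_{X̂}⁻¹ V̂_{X̂,θ̂₀}`. -/
def betaHatStar {N T M : ℕ} (𝒢 : Finset Date) (Ng : Date → ℕ)
    (a : Fin T → Date → Date → ℝ) (b : Fin M → Fin T → Date → Date → ℝ)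
    (y : Fin N → Fin T → ℝ) (d : Fin N → 𝒢) : Fin M → ℝ :=
  (VhatX 𝒢 Ng b y d)⁻¹.mulVec (VhatXtheta 𝒢 Ng a b y d)

/-- Plug-in efficient estimator `θ̂_{β̂*} = θ̂₀ - X̂'β̂*`. -/
def thetaHatPlug {N T M : ℕ} (𝒢 : Finset Date) (Ng : Date → ℕ)
    (a : Fin T → Date → Date → ℝ) (b : Fin M → Fin T → Date → Date → ℝ)
    (y : Fin N → Fin T → ℝ) (d : Fin N → 𝒢) : ℝ :=
  thetaHat0 𝒢 Ng a y d - ∑ j, Xhat 𝒢 Ng b y d j * betaHatStar 𝒢 Ng a b y d j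

/-- Neyman-style variance estimator `σ̂*²`. -/
def sigmaSqNeyman {N T M : ℕ} (𝒢 : Finset Date) (Ng : Date → ℕ)
    (a : Fin T → Date → Date → ℝ) (b : Fin M → Fin T → Date → Date → ℝ)
    (y : Fin N → Fin T → ℝ) (d : Fin N → 𝒢) : ℝ :=
  (∑ g ∈ 𝒢, ((N : ℝ) / (Ng g : ℝ)) *
      (Atheta T 𝒢 a g ⬝ᵥ (Shat Ng y d g).mulVec (Atheta T 𝒢 a g)))
  - (∑ g ∈ 𝒢, ((N : ℝ) / (Ng g : ℝ)) •
        ((A0 T M 𝒢 b g * Shat Ng y d g).mulVec (Atheta T 𝒢 a g))) ⬝ᵥ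
    ((∑ g ∈ 𝒢, ((N : ℝ) / (Ng g : ℝ)) •
        (A0 T M 𝒢 b g * Shat Ng y d g * (A0 T M 𝒢 b g)ᵀ))⁻¹.mulVec
      (∑ g ∈ 𝒢, ((N : ℝ) / (Ng g : ℝ)) •
        ((A0 T M 𝒢 b g * Shat Ng y d g).mulVec (Atheta T 𝒢 a g))))

/-- The `(g_min - 1) × T` selection matrix `M` picking out the periods before `g_min`. -/
def Msel (T gmin : ℕ) : Matrix (Fin (gmin - 1)) (Fin T) ℝ :=
  Matrix.of fun k t => if (t : ℕ) = (k : ℕ) then 1 else 0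

/-- `β̂_g = (M Ŝ_g M')⁻¹ M Ŝ_g A_{θ,g}'`. -/
def betaHatg {N T : ℕ} {𝒢 : Finset Date} (Ng : Date → ℕ) (a : Fin T → Date → Date → ℝ)
    (gmin : ℕ) (y : Fin N → Fin T → ℝ) (d : Fin N → 𝒢) (g : Date) : Fin (gmin - 1) → ℝ :=
  (Msel T gmin * Shat Ng y d g * (Msel T gmin)ᵀ)⁻¹.mulVec
    ((Msel T gmin * Shat Ng y d g).mulVec (Atheta T 𝒢 a g))

/-- Refined variance estimator `σ̂**²`. -/
def sigmaSqRefined {N T M : ℕ} (𝒢 : Finset Date) (Ng : Date → ℕ)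
    (a : Fin T → Date → Date → ℝ) (b : Fin M → Fin T → Date → Date → ℝ) (gmin : ℕ)
    (y : Fin N → Fin T → ℝ) (d : Fin N → 𝒢) : ℝ :=
  sigmaSqNeyman 𝒢 Ng a b y d -
    (∑ g ∈ 𝒢.filter fun g => (gmin : Date) ≤ g, betaHatg Ng a gmin y d g) ⬝ᵥ
      ((Msel T gmin * Shat Ng y d (gmin : Date) * (Msel T gmin)ᵀ).mulVec
        (∑ g ∈ 𝒢.filter fun g => (gmin : Date) ≤ g, betaHatg Ng a gmin y d g))

/-- Studentized plug-in efficient statistic `t = θ̂_{β̂*} / (σ̂** / √N)`. -/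
def tstat {N T M : ℕ} (𝒢 : Finset Date) (Ng : Date → ℕ)
    (a : Fin T → Date → Date → ℝ) (b : Fin M → Fin T → Date → Date → ℝ) (gmin : ℕ)
    (y : Fin N → Fin T → ℝ) (d : Fin N → 𝒢) : ℝ :=
  thetaHatPlug 𝒢 Ng a b y d /
    (Real.sqrt (sigmaSqRefined 𝒢 Ng a b gmin y d) / Real.sqrt (N : ℝ))

/-- Fisher randomization test p-value for the statistic `stat`, based on observed data
`(Y(G), G)` and recomputing the statistic with permuted assignments. -/
def pFRT {N T : ℕ} {𝒢 : Finset Date} (stat : (Fin N → Fin T → ℝ) → (Fin N → 𝒢) → ℝ)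
    (Y : Fin N → Date → Fin T → ℝ) (d : Fin N → 𝒢) : ℝ :=
  (((Finset.univ : Finset (Equiv.Perm (Fin N))).filter fun π =>
      stat (obs Y d) (fun i => d (π i)) ≥ stat (obs Y d) d).card : ℝ) /
    ((Finset.univ : Finset (Equiv.Perm (Fin N))).card : ℝ)

/-- Limit covariance matrix `V*_{X̂}`. -/
def VstarX (T M : ℕ) (𝒢 : Finset Date) (b : Fin M → Fin T → Date → Date → ℝ)
    (p : Date → ℝ) (Sstar : Date → Matrix (Fin T) (Fin T) ℝ) : Matrix (Fin M) (Fin M) ℝ :=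
  ∑ g ∈ 𝒢, (p g)⁻¹ • (A0 T M 𝒢 b g * Sstar g * (A0 T M 𝒢 b g)ᵀ)

/-- Limit covariance vector `V*_{X̂,θ̂₀}`. -/
def VstarXtheta (T M : ℕ) (𝒢 : Finset Date) (a : Fin T → Date → Date → ℝ)
    (b : Fin M → Fin T → Date → Date → ℝ) (p : Date → ℝ)
    (Sstar : Date → Matrix (Fin T) (Fin T) ℝ) : Fin M → ℝ :=
  ∑ g ∈ 𝒢, (p g)⁻¹ • ((A0 T M 𝒢 b g * Sstar g).mulVec (Atheta T 𝒢 a g))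

/-- Limit variance `V*_{θ̂₀}`. -/
def VstarTheta (T : ℕ) (𝒢 : Finset Date) (a : Fin T → Date → Date → ℝ) (p : Date → ℝ)
    (Sstar : Date → Matrix (Fin T) (Fin T) ℝ) (Sthetastar : ℝ) : ℝ :=
  (∑ g ∈ 𝒢, (p g)⁻¹ * (Atheta T 𝒢 a g ⬝ᵥ (Sstar g).mulVec (Atheta T 𝒢 a g))) - Sthetastar

/-- Asymptotic variance `σ*²` of the (plug-in) efficient estimator. -/
def sigmaSqLim (T M : ℕ) (𝒢 : Finset Date) (a : Fin T → Date → Date → ℝ)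
    (b : Fin M → Fin T → Date → Date → ℝ) (p : Date → ℝ)
    (Sstar : Date → Matrix (Fin T) (Fin T) ℝ) (Sthetastar : ℝ) : ℝ :=
  VstarTheta T 𝒢 a p Sstar Sthetastar -
    VstarXtheta T M 𝒢 a b p Sstar ⬝ᵥ
      (VstarX T M 𝒢 b p Sstar)⁻¹.mulVec (VstarXtheta T M 𝒢 a b p Sstar)

/-- A bounded real function. -/
def IsBounded (f : ℝ → ℝ) : Prop := ∃ C, ∀ x, |f x| ≤ C

end Staggered

namespace Staggered

lemma assigns_nonempty (N : ℕ) (𝒢 : Finset Date) (Ng : Date → ℕ)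
    (hsum : ∑ g ∈ 𝒢, Ng g = N) : (assigns N 𝒢 Ng).Nonempty := by
  have hc : Fintype.card (Fin N) = Fintype.card (Σ g : 𝒢, Fin (Ng g)) := by
    simp only [Fintype.card_sigma, Fintype.card_fin]
    rw [← hsum, ← Finset.sum_coe_sort]
  let e := Fintype.equivOfCardEq hc
  refine ⟨fun i => (e i).1, ?_⟩
  simp only [assigns, Finset.mem_filter, Finset.mem_univ, true_and]
  intro g hg
  have : (Finset.univ.filter fun i => ((e i).1 : Date) = g).card
      = (Finset.univ : Finset (Fin (Ng g))).card := by
    symm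
    refine Finset.card_bij (fun x _ => e.symm ⟨⟨g, hg⟩, x⟩) ?_ ?_ ?_
    · intro x _
      rw [Finset.mem_filter]
      exact ⟨Finset.mem_univ _, by rw [Equiv.apply_symm_apply]⟩
    · intro x _ y _ h
      have h' := e.symm.injective h
      exact eq_of_heq (Sigma.mk.inj h').2
    · intro i hi
      have h := (Finset.mem_filter.1 hi).2
      subst h
      exact ⟨(e i).2, Finset.mem_univ _, e.symm_apply_apply i⟩
  rw [this]; simp

lemma expec_perm (N : ℕ) (𝒢 : Finset Date) (Ng : Date → ℕ) (f : (Fin N → 𝒢) → ℝ)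
    (π : Equiv.Perm (Fin N)) :
    expec N 𝒢 Ng (fun d => f (fun i => d (π i))) = expec N 𝒢 Ng f := by
  unfold expec
  congr 1
  refine Finset.sum_equiv (Equiv.arrowCongr π.symm (Equiv.refl _)) ?_ ?_
  · intro d
    simp only [assigns, Finset.mem_filter, Finset.mem_univ, true_and]
    refine forall₂_congr fun g hg => ?_
    have : (Finset.univ.filter fun i => (d i : Date) = g).card =
      (Finset.univ.filter fun i => (((Equiv.arrowCongr π.symm (Equiv.refl _)) d i : 𝒢) : Date) = g).card := by
      refine Finset.card_equiv π.symm ?_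
      intro i
      simp
    rw [this]
  · intro d _
    rfl

lemma expec_sum {ι : Type*} (s : Finset ι) (N : ℕ) (𝒢 : Finset Date) (Ng : Date → ℕ)
    (f : ι → (Fin N → 𝒢) → ℝ) :
    expec N 𝒢 Ng (fun d => ∑ a ∈ s, f a d) = ∑ a ∈ s, expec N 𝒢 Ng (f a) := by
  unfold expec
  rw [Finset.sum_comm, Finset.sum_div]

lemma expec_mul (N : ℕ) (𝒢 : Finset Date) (Ng : Date → ℕ) (c : ℝ)
    (f : (Fin N → 𝒢) → ℝ) :
    expec N 𝒢 Ng (fun d => c * f d) = c * expec N 𝒢 Ng f := by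
  unfold expec
  rw [← Finset.mul_sum, mul_div_assoc]

lemma expec_congr {N : ℕ} {𝒢 : Finset Date} {Ng : Date → ℕ}
    {f h : (Fin N → 𝒢) → ℝ} (H : ∀ d ∈ assigns N 𝒢 Ng, f d = h d) :
    expec N 𝒢 Ng f = expec N 𝒢 Ng h := by
  unfold expec
  rw [Finset.sum_congr rfl H]

lemma expec_const (N : ℕ) (𝒢 : Finset Date) (Ng : Date → ℕ)
    (hsum : ∑ g ∈ 𝒢, Ng g = N) (c : ℝ) : expec N 𝒢 Ng (fun _ => c) = c := by
  unfold expec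
  have := (assigns_nonempty N 𝒢 Ng hsum).card_pos
  have h : ((assigns N 𝒢 Ng).card : ℝ) ≠ 0 := by positivity
  simp only [Finset.sum_const, nsmul_eq_mul]
  field_simp

/-- Treatment indicator. -/
def Dind {N : ℕ} {𝒢 : Finset Date} (i : Fin N) (g : Date) (d : Fin N → 𝒢) : ℝ :=
  if (d i : Date) = g then 1 else 0

lemma sum_Dind {N : ℕ} {𝒢 : Finset Date} {Ng : Date → ℕ} {d : Fin N → 𝒢}
    (hd : d ∈ assigns N 𝒢 Ng) {g : Date} (hg : g ∈ 𝒢) : ∑ i, Dind i g d = Ng g := by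
  simp only [assigns, Finset.mem_filter, Finset.mem_univ, true_and] at hd
  simp [Dind, ← hd g hg]

lemma Dind_mul {N : ℕ} {𝒢 : Finset Date} (i : Fin N) (g h : Date) (d : Fin N → 𝒢) :
    Dind i g d * Dind i h d = (if g = h then 1 else 0) * Dind i g d := by
  unfold Dind
  by_cases h1 : (d i : Date) = g <;> by_cases h2 : (d i : Date) = h <;> by_cases h3 : g = h <;>
    simp_all

lemma expec_D (N : ℕ) (𝒢 : Finset Date) (Ng : Date → ℕ) (hN : 2 ≤ N)
    (hsum : ∑ g ∈ 𝒢, Ng g = N) {g : Date} (hg : g ∈ 𝒢) (i : Fin N) :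
    expec N 𝒢 Ng (Dind i g) = Ng g / N := by
  have h1 : ∀ j, expec N 𝒢 Ng (Dind j g) = expec N 𝒢 Ng (Dind i g) := by
    intro j
    rw [← expec_perm N 𝒢 Ng (Dind j g) (Equiv.swap i j)]
    congr 1; funext d; simp [Dind]
  have h2 : ∑ j, expec N 𝒢 Ng (Dind j g) = Ng g := by
    rw [← expec_sum, expec_congr (fun d hd => sum_Dind hd hg), expec_const N 𝒢 Ng hsum]
  have hN0 : (N : ℝ) ≠ 0 := by positivity
  simp only [h1, Finset.sum_const, Finset.card_univ, Fintype.card_fin, nsmul_eq_mul] at h2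
  field_simp
  linarith

lemma expec_DD_ne (N : ℕ) (𝒢 : Finset Date) (Ng : Date → ℕ) (hN : 2 ≤ N)
    (hsum : ∑ g ∈ 𝒢, Ng g = N) {g h : Date} (hg : g ∈ 𝒢) (hh : h ∈ 𝒢) (i j : Fin N)
    (hij : i ≠ j) :
    expec N 𝒢 Ng (fun d => Dind i g d * Dind j h d) =
      (Ng g * Ng h - (if g = h then 1 else 0) * Ng g) / (N * (N - 1)) := by
  have h1 : ∀ j', j' ≠ i → expec N 𝒢 Ng (fun d => Dind i g d * Dind j' h d) =
      expec N 𝒢 Ng (fun d => Dind i g d * Dind j h d) := by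
    intro j' hj'
    rw [← expec_perm N 𝒢 Ng (fun d => Dind i g d * Dind j' h d) (Equiv.swap j j')]
    congr 1; funext d
    simp [Dind, Equiv.swap_apply_of_ne_of_ne hij hj'.symm]
  have h2 : ∑ j', expec N 𝒢 Ng (fun d => Dind i g d * Dind j' h d) = Ng h * (Ng g / N) := by
    rw [← expec_sum, ← expec_D N 𝒢 Ng hN hsum hg i, ← expec_mul]
    refine expec_congr fun d hd => ?_
    rw [← Finset.mul_sum, sum_Dind hd hh, mul_comm]
  have h3 : expec N 𝒢 Ng (fun d => Dind i g d * Dind i h d)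
      = (if g = h then 1 else 0) * (Ng g / N) := by
    simp only [Dind_mul]
    rw [expec_mul, expec_D N 𝒢 Ng hN hsum hg i]
  rw [← Finset.add_sum_erase _ _ (Finset.mem_univ i), h3,
    Finset.sum_congr rfl (fun j' hj' => h1 j' (Finset.ne_of_mem_erase hj'))] at h2
  simp only [Finset.sum_const, Finset.card_erase_of_mem (Finset.mem_univ i), Finset.card_univ,
    Fintype.card_fin, nsmul_eq_mul] at h2
  rw [Nat.cast_sub (by omega)] at h2
  have hN2 : (2 : ℝ) ≤ N := by exact_mod_cast hN
  have hN0 : (N : ℝ) ≠ 0 := by positivity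
  have hN1 : (N : ℝ) - 1 ≠ 0 := by linarith
  generalize expec N 𝒢 Ng (fun d => Dind i g d * Dind j h d) = x at *
  generalize (if g = h then (1 : ℝ) else 0) = δ at *
  field_simp at h2 ⊢
  push_cast at h2
  linarith

lemma covE_eq (N : ℕ) (𝒢 : Finset Date) (Ng : Date → ℕ)
    (hsum : ∑ g ∈ 𝒢, Ng g = N) (f h : (Fin N → 𝒢) → ℝ) :
    covE N 𝒢 Ng f h = expec N 𝒢 Ng (fun d => f d * h d) - expec N 𝒢 Ng f * expec N 𝒢 Ng h := by
  have := (assigns_nonempty N 𝒢 Ng hsum).card_pos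
  have hc : ((assigns N 𝒢 Ng).card : ℝ) ≠ 0 := by positivity
  unfold covE
  generalize ha : expec N 𝒢 Ng f = a
  generalize hb : expec N 𝒢 Ng h = b
  unfold expec at *
  rw [div_eq_iff hc] at ha hb
  simp only [sub_mul, mul_sub, Finset.sum_sub_distrib, ← Finset.sum_mul, ← Finset.mul_sum, ha, hb]
  simp only [Finset.sum_const, nsmul_eq_mul]
  field_simp
  ring

lemma cov_D (N : ℕ) (𝒢 : Finset Date) (Ng : Date → ℕ) (hN : 2 ≤ N)
    (hsum : ∑ g ∈ 𝒢, Ng g = N) {g h : Date} (hg : g ∈ 𝒢) (hh : h ∈ 𝒢) (i j : Fin N) :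
    covE N 𝒢 Ng (Dind i g) (Dind j h) =
      ((if g = h then 1 else 0) * Ng g / N - Ng g * Ng h / N ^ 2) *
        ((N * (if i = j then 1 else 0) - 1) / (N - 1)) := by
  have hN2 : (2 : ℝ) ≤ N := by exact_mod_cast hN
  have hN0 : (N : ℝ) ≠ 0 := by positivity
  have hN1 : (N : ℝ) - 1 ≠ 0 := by linarith
  rw [covE_eq N 𝒢 Ng hsum, expec_D N 𝒢 Ng hN hsum hg, expec_D N 𝒢 Ng hN hsum hh]
  by_cases hij : i = j
  · subst hij
    simp only [Dind_mul]
    rw [expec_mul, expec_D N 𝒢 Ng hN hsum hg i]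
    simp only [if_true]
    field_simp
  · rw [expec_DD_ne N 𝒢 Ng hN hsum hg hh i j hij]
    simp only [hij, if_false]
    field_simp
    ring

lemma covE_sum {ι κ : Type*} (s : Finset ι) (t : Finset κ) (N : ℕ) (𝒢 : Finset Date)
    (Ng : Date → ℕ) (hsum : ∑ g ∈ 𝒢, Ng g = N) (a : ι → ℝ) (b : κ → ℝ)
    (f : ι → (Fin N → 𝒢) → ℝ) (h : κ → (Fin N → 𝒢) → ℝ) :
    covE N 𝒢 Ng (fun d => ∑ x ∈ s, a x * f x d) (fun d => ∑ y ∈ t, b y * h y d) =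
      ∑ x ∈ s, ∑ y ∈ t, a x * b y * covE N 𝒢 Ng (f x) (h y) := by
  simp only [covE_eq N 𝒢 Ng hsum, expec_sum, expec_mul, Finset.sum_mul_sum, mul_sub,
    Finset.sum_sub_distrib]
  congr 1
  · refine Finset.sum_congr rfl fun x _ => Finset.sum_congr rfl fun y _ => ?_
    rw [← expec_mul]
    congr 1; funext d; ring
  · refine Finset.sum_congr rfl fun x _ => Finset.sum_congr rfl fun y _ => ?_
    ring

/-- Scalar finite-population covariance. -/
def scov (N : ℕ) (a b : Fin N → ℝ) : ℝ :=
  (∑ i, (a i - (∑ j, a j) / N) * (b i - (∑ j, b j) / N)) / ((N : ℝ) - 1)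

lemma scov_eq (N : ℕ) (hN : 2 ≤ N) (a b : Fin N → ℝ) :
    scov N a b = ∑ i, ∑ j, a i * b j * ((N * (if i = j then 1 else 0) - 1) / (N - 1)) / N := by
  have hN2 : (2 : ℝ) ≤ N := by exact_mod_cast hN
  have hN0 : (N : ℝ) ≠ 0 := by positivity
  have hN1 : (N : ℝ) - 1 ≠ 0 := by linarith
  have h1 : ∀ i j : Fin N, a i * b j * ((N * (if i = j then 1 else 0) - 1) / (N - 1)) / N =
      (if i = j then a i * b j else 0) / (N - 1) - a i * b j / (N * (N - 1)) := by
    intro i j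
    split_ifs <;> field_simp <;> ring
  simp only [h1, Finset.sum_sub_distrib, ← Finset.sum_div, ← Finset.sum_mul_sum,
    Finset.sum_ite_eq, Finset.mem_univ, if_true]
  unfold scov
  simp only [sub_mul, mul_sub, Finset.sum_sub_distrib, ← Finset.sum_mul, ← Finset.mul_sum]
  simp only [Finset.sum_const, nsmul_eq_mul, Finset.card_univ, Fintype.card_fin]
  field_simp
  ring

lemma scov_sum {ι κ : Type*} (s : Finset ι) (t : Finset κ) (N : ℕ) (hN : 2 ≤ N)
    (a : ι → Fin N → ℝ) (b : κ → Fin N → ℝ) :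
    scov N (fun i => ∑ x ∈ s, a x i) (fun i => ∑ y ∈ t, b y i) =
      ∑ x ∈ s, ∑ y ∈ t, scov N (a x) (b y) := by
  unfold scov
  have e1 : ∀ (i : Fin N),
      (∑ x ∈ s, a x i) - (∑ j, ∑ x ∈ s, a x j) / N = ∑ x ∈ s, (a x i - (∑ j, a x j) / N) := by
    intro i
    rw [Finset.sum_comm, Finset.sum_sub_distrib, Finset.sum_div]
  have e2 : ∀ (i : Fin N),
      (∑ x ∈ t, b x i) - (∑ j, ∑ x ∈ t, b x j) / N = ∑ x ∈ t, (b x i - (∑ j, b x j) / N) := by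
    intro i
    rw [Finset.sum_comm, Finset.sum_sub_distrib, Finset.sum_div]
  simp only [e1, e2, Finset.sum_mul_sum, ← Finset.sum_div]
  congr 1
  rw [Finset.sum_comm]
  exact Finset.sum_congr rfl fun x _ => Finset.sum_comm

lemma scov_smul (N : ℕ) (a b : Fin N → ℝ) (p q : ℝ) :
    scov N (fun i => p * a i) (fun i => q * b i) = p * q * scov N a b := by
  unfold scov
  rw [← mul_div_assoc, Finset.mul_sum]
  congr 1
  refine Finset.sum_congr rfl fun i _ => ?_
  rw [← Finset.mul_sum, ← Finset.mul_sum]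
  ring

lemma tau_eq {N T K : ℕ} (𝒢 : Finset Date) (Ng : Date → ℕ) (Y : Fin N → Date → Fin T → ℝ)
    (A : Date → Matrix (Fin K) (Fin T) ℝ) (k : Fin K) (d : Fin N → 𝒢) :
    ∑ g ∈ 𝒢, (A g).mulVec (cmean Ng (obs Y d) d g) k =
      ∑ x ∈ 𝒢 ×ˢ (Finset.univ : Finset (Fin N)),
        ((A x.1).mulVec (Y x.2 x.1) k / Ng x.1) * Dind x.2 x.1 d := by
  rw [Finset.sum_product]
  refine Finset.sum_congr rfl fun g _ => ?_
  simp only [Matrix.mulVec, dotProduct, cmean, obs, Finset.sum_div, Finset.mul_sum, Finset.sum_mul]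
  rw [Finset.sum_comm]
  refine Finset.sum_congr rfl fun i _ => Finset.sum_congr rfl fun t _ => ?_
  unfold Dind
  split_ifs with h
  · rw [h]; ring
  · simp

lemma ASA_eq {N T K : ℕ} (hN : 2 ≤ N) (Y : Fin N → Date → Fin T → ℝ)
    (A : Matrix (Fin K) (Fin T) ℝ) (g : Date) (k l : Fin K) :
    (A * Sg N T Y g * Aᵀ) k l =
      scov N (fun i => A.mulVec (Y i g) k) (fun i => A.mulVec (Y i g) l) := by
  simp only [Matrix.mulVec, dotProduct]
  rw [scov_sum _ _ N hN (fun t i => A k t * Y i g t) (fun t i => A l t * Y i g t)]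
  simp only [scov_smul, Matrix.mul_apply, Matrix.transpose_apply, Finset.sum_mul]
  rw [Finset.sum_comm]
  refine Finset.sum_congr rfl fun t _ => Finset.sum_congr rfl fun u _ => ?_
  simp only [Sg, popCov, popMeanV, scov, Matrix.of_apply]
  ring


/-- Finite-population variance of linear combinations of cohort means:
under Assumption 1, `τ̂ = Σ_g A_g Ȳ_g` has covariance matrix
`Var(τ̂) = Σ_g N_g⁻¹ A_g S_g A_g' - N⁻¹ S_A`. -/
theorem statement4
    (N T K : ℕ) (𝒢 : Finset Date) (Ng : Date → ℕ) (Y : Fin N → Date → Fin T → ℝ)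
    (A : Date → Matrix (Fin K) (Fin T) ℝ)
    (hK : 0 < K) (hN : 2 ≤ N) (h𝒢ne : 𝒢.Nonempty)
    (h𝒢 : ∀ g ∈ 𝒢, (1 ≤ g ∧ g ≤ (T : Date)) ∨ g = ⊤)
    (hNg : ∀ g ∈ 𝒢, 1 ≤ Ng g) (hsum : ∑ g ∈ 𝒢, Ng g = N) :
    ∀ k l : Fin K,
      covE N 𝒢 Ng (fun d => ∑ g ∈ 𝒢, (A g).mulVec (cmean Ng (obs Y d) d g) k)
        (fun d => ∑ g ∈ 𝒢, (A g).mulVec (cmean Ng (obs Y d) d g) l) =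
      (∑ g ∈ 𝒢, ((Ng g : ℝ))⁻¹ • (A g * Sg N T Y g * (A g)ᵀ)) k l -
        ((N : ℝ))⁻¹ * popCov N K (fun i k' => ∑ g ∈ 𝒢, (A g).mulVec (Y i g) k') k l := by
  intro k l
  have hN2 : (2 : ℝ) ≤ N := by exact_mod_cast hN
  have hN0 : (N : ℝ) ≠ 0 := by positivity
  have hR : popCov N K (fun i k' => ∑ g ∈ 𝒢, (A g).mulVec (Y i g) k') k l =
      ∑ g ∈ 𝒢, ∑ h ∈ 𝒢, scov N (fun i => (A g).mulVec (Y i g) k)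
        (fun i => (A h).mulVec (Y i h) l) := by
    rw [← scov_sum 𝒢 𝒢 N hN (fun g i => (A g).mulVec (Y i g) k)
      (fun g i => (A g).mulVec (Y i g) l)]
    rfl
  rw [hR, Matrix.sum_apply]
  simp only [Matrix.smul_apply, ASA_eq hN, smul_eq_mul]
  simp only [tau_eq]
  rw [covE_sum _ _ N 𝒢 Ng hsum (fun x : Date × Fin N => (A x.1).mulVec (Y x.2 x.1) k / Ng x.1)
    (fun x : Date × Fin N => (A x.1).mulVec (Y x.2 x.1) l / Ng x.1)
    (fun x : Date × Fin N => Dind x.2 x.1) (fun x : Date × Fin N => Dind x.2 x.1)]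
  simp only [Finset.sum_product]
  rw [Finset.mul_sum, ← Finset.sum_sub_distrib]
  refine Finset.sum_congr rfl fun g hg => ?_
  rw [Finset.sum_comm, Finset.mul_sum]
  have hd : ((Ng g : ℝ))⁻¹ * scov N (fun i => (A g).mulVec (Y i g) k)
        (fun i => (A g).mulVec (Y i g) l) =
      ∑ h ∈ 𝒢, (if g = h then ((Ng g : ℝ))⁻¹ * scov N (fun i => (A g).mulVec (Y i g) k)
        (fun i => (A h).mulVec (Y i h) l) else 0) := by
    rw [Finset.sum_ite_eq, if_pos hg]
  rw [hd, ← Finset.sum_sub_distrib]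
  refine Finset.sum_congr rfl fun h hh => ?_
  have hg0 : (Ng g : ℝ) ≠ 0 := by have := hNg g hg; positivity
  have hh0 : (Ng h : ℝ) ≠ 0 := by have := hNg h hh; positivity
  simp only [cov_D N 𝒢 Ng hN hsum hg hh]
  have : (if g = h then ((Ng g : ℝ))⁻¹ * scov N (fun i => (A g).mulVec (Y i g) k)
        (fun i => (A h).mulVec (Y i h) l) else 0) - (N : ℝ)⁻¹ *
        scov N (fun i => (A g).mulVec (Y i g) k) (fun i => (A h).mulVec (Y i h) l) =
      ((if g = h then 1 else 0) * ((Ng g : ℝ))⁻¹ - (N : ℝ)⁻¹) *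
        scov N (fun i => (A g).mulVec (Y i g) k) (fun i => (A h).mulVec (Y i h) l) := by
    split_ifs <;> ring
  rw [this, scov_eq N hN, Finset.mul_sum]
  refine Finset.sum_congr rfl fun i _ => ?_
  rw [Finset.mul_sum]
  refine Finset.sum_congr rfl fun j _ => ?_
  generalize ((N : ℝ) * (if i = j then 1 else 0) - 1) / (N - 1) = w
  by_cases hgh : g = h
  · subst hgh
    simp only [if_true]
    field_simp
  · simp only [hgh, if_false]
    field_simp
    ring
end Staggered
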